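/- Let d ≥ 1, let Γ be a d×d symmetric positive definite real matrix, and let R be a lower triangular P-matrix (R_{ij} = 0 for i < j and every principal minor positive). Suppose that for each r ∈ (0,1) the Borel probability measures π^r, ν_1^r, …, ν_d^r on ℝ₊^d satisfy the basic adjoint relationship. Then there exists r₀ ∈ (0,1] such that for every k ∈ {1,…,d} and every integer n ≥ 0 there are finite constants C_{k,n} and C_{i,k,n} (i = 1,…,d) with: ∫(r^k z_k)^n dπ^r(z) < C_{k,n} and r^{i−1} ∫(r^k z_k)^n dν_i^r(z) < C_{i,k,n} for all i ∈ {1,…,d} and all r ∈ (0, r₀). In particular, the uniform moment bound condition holds. -/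

import Mathlib

open MeasureTheory Filter

noncomputable section

namespace SRBMPaper

/-- The nonnegative orthant `ℝ₊^d`. -/
def posOrthant (d : ℕ) : Set (Fin d → ℝ) := {z | ∀ i, 0 ≤ z i}

/-- `R` is a P-matrix: every principal minor is positive. -/
def IsPMatrix {d : ℕ} (R : Matrix (Fin d) (Fin d) ℝ) : Prop :=
  ∀ s : Finset (Fin d),
    0 < (R.submatrix (fun i : s => (i : Fin d)) (fun i : s => (i : Fin d))).det

/-- `R` is a nonsingular M-matrix: nonpositive off-diagonal entries and
every principal minor positive. -/
def IsMMatrix {d : ℕ} (R : Matrix (Fin d) (Fin d) ℝ) : Prop :=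
  (∀ i j, i ≠ j → R i j ≤ 0) ∧ IsPMatrix R

/-- First-order partial derivative of `f` in coordinate `j`. -/
def pd1 {d : ℕ} (f : (Fin d → ℝ) → ℝ) (j : Fin d) (z : Fin d → ℝ) : ℝ :=
  fderiv ℝ f z (Pi.single j 1)

/-- Second-order partial derivative of `f` in coordinates `i`, `j`. -/
def pd2 {d : ℕ} (f : (Fin d → ℝ) → ℝ) (i j : Fin d) (z : Fin d → ℝ) : ℝ :=
  fderiv ℝ (fun w => pd1 f j w) z (Pi.single i 1)

/-- `f` is twice continuously differentiable and `f` together with all of its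
first- and second-order partial derivatives is bounded on the orthant. -/
def IsC2Bounded {d : ℕ} (f : (Fin d → ℝ) → ℝ) : Prop :=
  ContDiff ℝ 2 f ∧
    ∃ C : ℝ, ∀ z ∈ posOrthant d,
      |f z| ≤ C ∧ (∀ j, |pd1 f j z| ≤ C) ∧ (∀ i j, |pd2 f i j z| ≤ C)

/-- The basic adjoint relationship (BAR) at traffic-intensity parameter `r`. -/
def SatisfiesBAR {d : ℕ} (Γ R : Matrix (Fin d) (Fin d) ℝ) (r : ℝ)
    (π : Measure (Fin d → ℝ)) (ν : Fin d → Measure (Fin d → ℝ)) : Prop :=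
  ∀ f : (Fin d → ℝ) → ℝ, IsC2Bounded f →
    (1 / 2) * (∫ z, ∑ i, ∑ j, Γ i j * pd2 f i j z ∂π)
      - (∑ i : Fin d, r ^ ((i : ℕ) + 1) * ∫ z, ∑ j, R j i * pd1 f j z ∂π)
      + (∑ i : Fin d, r ^ ((i : ℕ) + 1) * ∫ z, ∑ j, R j i * pd1 f j z ∂(ν i)) = 0

/-- For every `r ∈ (0,1)`, `π r` is a Borel probability measure on the orthant,
each `ν i r` is a Borel probability measure on the face `{z i = 0}` of the orthant,
and together they satisfy the basic adjoint relationship. -/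
def BARFamily {d : ℕ} (Γ R : Matrix (Fin d) (Fin d) ℝ)
    (π : ℝ → Measure (Fin d → ℝ)) (ν : Fin d → ℝ → Measure (Fin d → ℝ)) : Prop :=
  ∀ r ∈ Set.Ioo (0 : ℝ) 1,
    IsProbabilityMeasure (π r) ∧ π r (posOrthant d) = 1 ∧
    (∀ i, IsProbabilityMeasure (ν i r) ∧
      ν i r {z | z ∈ posOrthant d ∧ z i = 0} = 1) ∧
    SatisfiesBAR Γ R r (π r) (fun i => ν i r)

/-- `u` is the vector `u_k` associated with the matrix `R`:
`u_k = (w_{1k}, …, w_{k-1,k}, 1, 0, …, 0)ᵀ` where the weights solve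
`∑_{j<k} w_{jk} R_{jℓ} + R_{kℓ} = 0` for all `ℓ < k`. -/
def IsUk {d : ℕ} (R : Matrix (Fin d) (Fin d) ℝ) (k : Fin d) (u : Fin d → ℝ) : Prop :=
  u k = 1 ∧ (∀ j, k < j → u j = 0) ∧
    ∀ ℓ, ℓ < k →
      (∑ j ∈ Finset.univ.filter (fun j => j < k), u j * R j ℓ) + R k ℓ = 0

/-- `uᵀ R_{:,i}`, the pairing of `u` with the `i`-th column of `R`. -/
def uR {d : ℕ} (R : Matrix (Fin d) (Fin d) ℝ) (u : Fin d → ℝ) (i : Fin d) : ℝ :=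
  ∑ j, u j * R j i

/-- The quadratic form `uᵀ Γ u`. -/
def quadForm {d : ℕ} (Γ : Matrix (Fin d) (Fin d) ℝ) (u : Fin d → ℝ) : ℝ :=
  ∑ i, ∑ j, u i * Γ i j * u j

/-- The limiting mean `m_k = (u_kᵀ Γ u_k) / (2 u_kᵀ R_{:,k})`. -/
def meanOf {d : ℕ} (Γ R : Matrix (Fin d) (Fin d) ℝ) (u : Fin d → ℝ) (k : Fin d) : ℝ :=
  quadForm Γ u / (2 * uR R u k)

/-- The exponential distribution on `ℝ` with mean `m`. -/
def expMean (m : ℝ) : Measure ℝ :=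
  (volume : Measure ℝ).withDensity fun x =>
    ENNReal.ofReal (if 0 ≤ x then m⁻¹ * Real.exp (-x / m) else 0)

/-- The law of a vector of independent exponential random variables with means `m k`. -/
def prodExp {d : ℕ} (m : Fin d → ℝ) : Measure (Fin d → ℝ) :=
  Measure.pi fun k => expMean (m k)

/-- The pushforwards of `π r` under `z ↦ (r z_1, r² z_2, …, r^d z_d)` converge weakly
to `μ` as `r → 0` (convergence tested against bounded continuous functions). -/
def ScaledWeakLimit {d : ℕ} (π : ℝ → Measure (Fin d → ℝ)) (μ : Measure (Fin d → ℝ)) : Prop :=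
  ∀ g : BoundedContinuousFunction (Fin d → ℝ) ℝ,
    Tendsto (fun r : ℝ => ∫ z, g (fun i => r ^ ((i : ℕ) + 1) * z i) ∂(π r))
      (nhdsWithin 0 (Set.Ioo 0 1)) (nhds (∫ z, g z ∂μ))

/-- The uniform moment bound condition: for all coordinates `i, k`, the `d`-th moment
of `r^k Z_k` under `π r` is bounded for small `r`, and `r` times its `d`-th moment
under `ν i r` tends to `0` as `r → 0`. -/
def UniformMomentBound {d : ℕ} (π : ℝ → Measure (Fin d → ℝ))
    (ν : Fin d → ℝ → Measure (Fin d → ℝ)) : Prop :=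
  ∀ i k : Fin d,
    (∃ r₁ > (0 : ℝ), ∃ C : ℝ, ∀ r ∈ Set.Ioo (0 : ℝ) (min r₁ 1),
      (∫ z, (r ^ ((k : ℕ) + 1) * z k) ^ d ∂(π r)) ≤ C) ∧
    Tendsto (fun r : ℝ => r * ∫ z, (r ^ ((k : ℕ) + 1) * z k) ^ d ∂(ν i r))
      (nhdsWithin 0 (Set.Ioo 0 1)) (nhds 0)

/-- The truncation function `κ`. -/
def kappa (x : ℝ) : ℝ :=
  if x ≤ 1 then x
  else if x ≤ 2 then 3*x^5 - 22*x^4 + 62*x^3 - 84*x^2 + 56*x - 14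
  else 2

/-- The vector `θ_k^{(r)} = ∑_{ℓ=k}^d r^ℓ η_ℓ u_ℓ`. -/
def thetaK {d : ℕ} (u : Fin d → Fin d → ℝ) (η : Fin d → ℝ) (k : Fin d) (r : ℝ) :
    Fin d → ℝ :=
  fun j => ∑ ℓ ∈ Finset.univ.filter (fun ℓ => k ≤ ℓ), r ^ ((ℓ : ℕ) + 1) * η ℓ * u ℓ j

/-- The vector `θ̃_k^{(r)} = r^{k+1/2} η_k u_k + ∑_{ℓ=k+1}^d r^ℓ η_ℓ u_ℓ`. -/
def thetaKt {d : ℕ} (u : Fin d → Fin d → ℝ) (η : Fin d → ℝ) (k : Fin d) (r : ℝ) :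
    Fin d → ℝ :=
  fun j => r ^ ((((k : ℕ) : ℝ) + 1) + 1/2) * η k * u k j
    + ∑ ℓ ∈ Finset.univ.filter (fun ℓ => k < ℓ), r ^ ((ℓ : ℕ) + 1) * η ℓ * u ℓ j

/-- The truncated exponential test function `f̃_θ(z) = exp(∑ κ(θ_i z_i))`. -/
def ftilde {d : ℕ} (θ z : Fin d → ℝ) : ℝ := Real.exp (∑ i, kappa (θ i * z i))

/-- Gradient extra term `ε_{g,θ,j}(z) = θ_j (κ'(θ_j z_j) − 1)`. -/
def epsG {d : ℕ} (θ : Fin d → ℝ) (j : Fin d) (z : Fin d → ℝ) : ℝ :=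
  θ j * (deriv kappa (θ j * z j) - 1)

/-- Hessian extra term `ε_{H,θ,ij}(z)`. -/
def epsH {d : ℕ} (θ : Fin d → ℝ) (i j : Fin d) (z : Fin d → ℝ) : ℝ :=
  θ i * θ j * (deriv kappa (θ i * z i) * deriv kappa (θ j * z j) - 1)
    + (if i = j then θ i ^ 2 * deriv (deriv kappa) (θ i * z i) else 0)

/-- The extra term `γ^r(θ)` in the truncated MGF-BAR. -/
def gammaTerm {d : ℕ} (Γ R : Matrix (Fin d) (Fin d) ℝ) (r : ℝ)
    (π : Measure (Fin d → ℝ)) (ν : Fin d → Measure (Fin d → ℝ))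
    (θ : Fin d → ℝ) : ℝ :=
  (1/2) * (∫ z, (∑ i, ∑ j, Γ i j * epsH θ i j z) * ftilde θ z ∂π)
    + ∑ i : Fin d, r ^ ((i : ℕ) + 1) *
        ((∫ z, (∑ j, epsG θ j z * R j i) * ftilde θ z ∂(ν i))
          - ∫ z, (∑ j, epsG θ j z * R j i) * ftilde θ z ∂π)


/-- `A` is a bounded `C²` function with bounded first and second derivatives `A'`, `A''`. -/
structure IsTestFun (A A' A'' : ℝ → ℝ) : Prop where
  contDiff : ContDiff ℝ 2 A
  hasDerivAt : ∀ x, HasDerivAt A (A' x) x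
  hasDerivAt' : ∀ x, HasDerivAt A' (A'' x) x
  continuous'' : Continuous A''
  bounded : ∃ C, ∀ x, |A x| ≤ C ∧ |A' x| ≤ C ∧ |A'' x| ≤ C

/-- The linear functional `z ↦ ∑ j, a j * z j`. -/
def dotL {d : ℕ} (a : Fin d → ℝ) : (Fin d → ℝ) →L[ℝ] ℝ :=
  ∑ j, a j • ContinuousLinearMap.proj (R := ℝ) (φ := fun _ : Fin d => ℝ) j

lemma dotL_apply {d : ℕ} (a z : Fin d → ℝ) : dotL a z = ∑ j, a j * z j := by
  simp [dotL]

lemma dotL_single {d : ℕ} (a : Fin d → ℝ) (j : Fin d) : dotL a (Pi.single j 1) = a j := by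
  simp [dotL_apply, Pi.single_apply]

lemma dotL_smul_single {d : ℕ} (c : ℝ) (i : Fin d) (z : Fin d → ℝ) :
    dotL (Pi.single i c) z = c * z i := by
  simp [dotL_apply, Pi.single_apply]

lemma pd1_mul {d : ℕ} {A A' B B' : ℝ → ℝ} (hA : ∀ x, HasDerivAt A (A' x) x)
    (hB : ∀ x, HasDerivAt B (B' x) x) (a b : Fin d → ℝ) (j : Fin d) (z : Fin d → ℝ) :
    pd1 (fun z => A (dotL a z) * B (dotL b z)) j z
      = a j * (A' (dotL a z) * B (dotL b z)) + b j * (A (dotL a z) * B' (dotL b z)) := by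
  have h := ((hA (dotL a z)).comp_hasFDerivAt z (dotL a).hasFDerivAt).mul
    ((hB (dotL b z)).comp_hasFDerivAt z (dotL b).hasFDerivAt)
  have h' : HasFDerivAt (fun z => A (dotL a z) * B (dotL b z)) _ z := h
  rw [pd1, h'.fderiv]
  simp [dotL_single]
  ring

lemma pd2_mul {d : ℕ} {A A' A'' B B' B'' : ℝ → ℝ} (hA : IsTestFun A A' A'')
    (hB : IsTestFun B B' B'') (a b : Fin d → ℝ) (i j : Fin d) (z : Fin d → ℝ) :
    pd2 (fun z => A (dotL a z) * B (dotL b z)) i j z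
      = a i * a j * (A'' (dotL a z) * B (dotL b z))
        + (a i * b j + b i * a j) * (A' (dotL a z) * B' (dotL b z))
        + b i * b j * (A (dotL a z) * B'' (dotL b z)) := by
  have hfun : (fun w => pd1 (fun z => A (dotL a z) * B (dotL b z)) j w) = fun z =>
      a j * (A' (dotL a z) * B (dotL b z)) + b j * (A (dotL a z) * B' (dotL b z)) := by
    funext w
    exact pd1_mul hA.hasDerivAt hB.hasDerivAt a b j w
  have cA := (hA.hasDerivAt (dotL a z)).comp_hasFDerivAt z (dotL a).hasFDerivAt
  have cA' := (hA.hasDerivAt' (dotL a z)).comp_hasFDerivAt z (dotL a).hasFDerivAt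
  have cB := (hB.hasDerivAt (dotL b z)).comp_hasFDerivAt z (dotL b).hasFDerivAt
  have cB' := (hB.hasDerivAt' (dotL b z)).comp_hasFDerivAt z (dotL b).hasFDerivAt
  have h : HasFDerivAt (fun z => a j * (A' (dotL a z) * B (dotL b z))
      + b j * (A (dotL a z) * B' (dotL b z))) _ z :=
    ((cA'.mul cB).const_mul (a j)).add ((cA.mul cB').const_mul (b j))
  rw [pd2, hfun, h.fderiv]
  simp [dotL_single]
  ring

lemma abs_mul_le_mul {x y C D : ℝ} (hx : |x| ≤ C) (hy : |y| ≤ D) : |x * y| ≤ C * D := by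
  rw [abs_mul]
  exact mul_le_mul hx hy (abs_nonneg _) ((abs_nonneg _).trans hx)

lemma isC2Bounded_mul {d : ℕ} {A A' A'' B B' B'' : ℝ → ℝ} (hA : IsTestFun A A' A'')
    (hB : IsTestFun B B' B'') (a b : Fin d → ℝ) :
    IsC2Bounded (fun z => A (dotL a z) * B (dotL b z)) := by
  obtain ⟨C, hC⟩ := hA.bounded
  obtain ⟨D, hD⟩ := hB.bounded
  refine ⟨(hA.contDiff.comp (dotL a).contDiff).mul (hB.contDiff.comp (dotL b).contDiff), ?_⟩
  have hC0 : 0 ≤ C := (abs_nonneg _).trans (hC 0).1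
  have hD0 : 0 ≤ D := (abs_nonneg _).trans (hD 0).1
  have hCD : 0 ≤ C * D := mul_nonneg hC0 hD0
  set S : ℝ := ∑ j, (|a j| + |b j|) with hS
  have hSj : ∀ j, |a j| + |b j| ≤ S := fun j =>
    Finset.single_le_sum (f := fun j => |a j| + |b j|) (fun i _ => by positivity)
      (Finset.mem_univ j)
  have hS0 : 0 ≤ S := Finset.sum_nonneg fun i _ => by positivity
  refine ⟨(1 + S + S * S) * (C * D), fun z _ => ⟨?_, fun j => ?_, fun i j => ?_⟩⟩
  · refine (abs_mul_le_mul (hC _).1 (hD _).1).trans ?_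
    nlinarith [mul_nonneg hS0 hCD, mul_nonneg (mul_nonneg hS0 hS0) hCD]
  · rw [pd1_mul hA.hasDerivAt hB.hasDerivAt]
    calc _ ≤ |a j| * (C * D) + |b j| * (C * D) := by
            refine (abs_add_le _ _).trans (add_le_add ?_ ?_) <;> rw [abs_mul]
            · exact mul_le_mul_of_nonneg_left (abs_mul_le_mul (hC _).2.1 (hD _).1) (abs_nonneg _)
            · exact mul_le_mul_of_nonneg_left (abs_mul_le_mul (hC _).1 (hD _).2.1) (abs_nonneg _)
      _ ≤ S * (C * D) := by nlinarith [hSj j]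
      _ ≤ _ := by nlinarith [mul_nonneg (mul_nonneg hS0 hS0) hCD]
  · rw [pd2_mul hA hB]
    calc _ ≤ |a i| * |a j| * (C * D) + (|a i| * |b j| + |b i| * |a j|) * (C * D)
            + |b i| * |b j| * (C * D) := by
            refine (abs_add_three _ _ _).trans (add_le_add (add_le_add ?_ ?_) ?_)
            · rw [abs_mul, abs_mul]
              exact mul_le_mul_of_nonneg_left (abs_mul_le_mul (hC _).2.2 (hD _).1) (by positivity)
            · rw [abs_mul]
              refine mul_le_mul ?_ (abs_mul_le_mul (hC _).2.1 (hD _).2.1) (abs_nonneg _)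
                (by positivity)
              refine (abs_add_le _ _).trans ?_
              rw [abs_mul, abs_mul]
            · rw [abs_mul, abs_mul]
              exact mul_le_mul_of_nonneg_left (abs_mul_le_mul (hC _).1 (hD _).2.2) (by positivity)
      _ = ((|a i| + |b i|) * (|a j| + |b j|)) * (C * D) := by ring
      _ ≤ (S * S) * (C * D) := by
            refine mul_le_mul_of_nonneg_right ?_ hCD
            exact mul_le_mul (hSj i) (hSj j) (by positivity) hS0
      _ ≤ _ := by nlinarith [mul_nonneg hS0 hCD]

/-- The basic adjoint relationship for a product of ridge functions. -/
lemma SatisfiesBAR.mul {d : ℕ} {Γ R : Matrix (Fin d) (Fin d) ℝ} {r : ℝ}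
    {π : Measure (Fin d → ℝ)} {ν : Fin d → Measure (Fin d → ℝ)} (h : SatisfiesBAR Γ R r π ν)
    {A A' A'' B B' B'' : ℝ → ℝ} (hA : IsTestFun A A' A'')
    (hB : IsTestFun B B' B'') (a b : Fin d → ℝ) :
    (1 / 2) * (∫ z, (∑ i, ∑ j, Γ i j * (a i * a j)) * (A'' (dotL a z) * B (dotL b z))
        + (∑ i, ∑ j, Γ i j * (a i * b j + b i * a j)) * (A' (dotL a z) * B' (dotL b z))
        + (∑ i, ∑ j, Γ i j * (b i * b j)) * (A (dotL a z) * B'' (dotL b z)) ∂π)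
      - (∑ i : Fin d, r ^ ((i : ℕ) + 1) * ∫ z, uR R a i * (A' (dotL a z) * B (dotL b z))
          + uR R b i * (A (dotL a z) * B' (dotL b z)) ∂π)
      + (∑ i : Fin d, r ^ ((i : ℕ) + 1) * ∫ z, uR R a i * (A' (dotL a z) * B (dotL b z))
          + uR R b i * (A (dotL a z) * B' (dotL b z)) ∂(ν i)) = 0 := by
  have key := h _ (isC2Bounded_mul hA hB a b)
  have e1 : ∀ z i, ∑ j, R j i * pd1 (fun z => A (dotL a z) * B (dotL b z)) j z
      = uR R a i * (A' (dotL a z) * B (dotL b z))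
          + uR R b i * (A (dotL a z) * B' (dotL b z)) := by
    intro z i
    rw [uR, uR, Finset.sum_mul, Finset.sum_mul, ← Finset.sum_add_distrib]
    refine Finset.sum_congr rfl fun j _ => ?_
    rw [pd1_mul hA.hasDerivAt hB.hasDerivAt]
    ring
  have e2 : ∀ z, ∑ i, ∑ j, Γ i j * pd2 (fun z => A (dotL a z) * B (dotL b z)) i j z
      = (∑ i, ∑ j, Γ i j * (a i * a j)) * (A'' (dotL a z) * B (dotL b z))
        + (∑ i, ∑ j, Γ i j * (a i * b j + b i * a j)) * (A' (dotL a z) * B' (dotL b z))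
        + (∑ i, ∑ j, Γ i j * (b i * b j)) * (A (dotL a z) * B'' (dotL b z)) := by
    intro z
    simp only [Finset.sum_mul, ← Finset.sum_add_distrib]
    refine Finset.sum_congr rfl fun i _ => Finset.sum_congr rfl fun j _ => ?_
    rw [pd2_mul hA hB]
    ring
  simpa only [e1, e2] using key

lemma isTestFun_one : IsTestFun (fun _ => 1) (fun _ => 0) (fun _ => 0) where
  contDiff := contDiff_const
  hasDerivAt x := hasDerivAt_const x 1
  hasDerivAt' x := hasDerivAt_const x 0
  continuous'' := continuous_const
  bounded := ⟨1, fun x => by norm_num⟩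

lemma isTestFun_sin : IsTestFun Real.sin Real.cos (fun x => -Real.sin x) where
  contDiff := Real.contDiff_sin
  hasDerivAt := Real.hasDerivAt_sin
  hasDerivAt' := Real.hasDerivAt_cos
  continuous'' := by fun_prop
  bounded := ⟨1, fun x => ⟨Real.abs_sin_le_one x, Real.abs_cos_le_one x, by
    rw [abs_neg]; exact Real.abs_sin_le_one x⟩⟩

/-- A bounded smooth truncation of the identity. -/
def trunc (ε x : ℝ) : ℝ := Real.arctan (ε * x) / ε

/-- The derivative of `trunc ε`. -/
def trunc' (ε x : ℝ) : ℝ := 1 / (1 + (ε * x) ^ 2)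

/-- The second derivative of `trunc ε`. -/
def trunc'' (ε x : ℝ) : ℝ := -(2 * ε * (ε * x)) / (1 + (ε * x) ^ 2) ^ 2

lemma hasDerivAt_trunc {ε : ℝ} (hε : 0 < ε) (x : ℝ) :
    HasDerivAt (trunc ε) (trunc' ε x) x := by
  have h := (((hasDerivAt_id x).const_mul ε).arctan).div_const ε
  refine h.congr_deriv ?_
  simp only [trunc', id]
  field_simp

lemma hasDerivAt_trunc' (ε x : ℝ) : HasDerivAt (trunc' ε) (trunc'' ε x) x := by
  have h1 : HasDerivAt (fun x => 1 + (ε * x) ^ 2) (2 * ε * (ε * x)) x := by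
    have := (((hasDerivAt_id x).const_mul ε).pow 2).const_add 1
    refine this.congr_deriv ?_
    simp only [id]
    norm_num
    ring
  have h := (hasDerivAt_const x (1 : ℝ)).div h1 (by positivity)
  refine h.congr_deriv ?_
  simp [trunc'']

lemma trunc'_pos (ε x : ℝ) : 0 < trunc' ε x := by
  unfold trunc'; positivity

lemma trunc'_le_one (ε x : ℝ) : trunc' ε x ≤ 1 := by
  unfold trunc'
  rw [div_le_one (by positivity)]
  nlinarith [sq_nonneg (ε * x)]

lemma abs_trunc''_le {ε : ℝ} (hε : 0 < ε) (x : ℝ) : |trunc'' ε x| ≤ ε * trunc' ε x := by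
  unfold trunc' trunc''
  rw [abs_div, abs_neg, abs_of_pos (a := (1 + (ε * x) ^ 2) ^ 2) (by positivity),
    div_le_iff₀ (by positivity)]
  have h : ε * (1 / (1 + (ε * x) ^ 2)) * (1 + (ε * x) ^ 2) ^ 2 = ε * (1 + (ε * x) ^ 2) := by
    field_simp
  rw [h, abs_mul, abs_of_pos (by positivity : 0 < 2 * ε)]
  nlinarith [sq_nonneg (|ε * x| - 1), sq_abs (ε * x)]

lemma abs_arctan_le_abs (x : ℝ) : |Real.arctan x| ≤ |x| := by
  have h := Convex.norm_image_sub_le_of_norm_hasDerivWithin_le (f := Real.arctan)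
    (f' := fun x => 1 / (1 + x ^ 2)) (C := 1) (s := Set.univ) (x := 0) (y := x)
    (fun y _ => (Real.hasDerivAt_arctan y).hasDerivWithinAt) (fun y _ => by
      rw [Real.norm_of_nonneg (by positivity), div_le_one (by positivity)]
      nlinarith [sq_nonneg y]) convex_univ trivial trivial
  simpa using h

lemma abs_trunc_le {ε : ℝ} (hε : 0 < ε) (x : ℝ) : |trunc ε x| ≤ |x| := by
  unfold trunc
  rw [abs_div, abs_of_pos hε, div_le_iff₀ hε]
  refine (abs_arctan_le_abs _).trans ?_
  rw [abs_mul, abs_of_pos hε, mul_comm]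

lemma abs_trunc_le' {ε : ℝ} (hε : 0 < ε) (x : ℝ) : |trunc ε x| ≤ 2 / ε := by
  unfold trunc
  rw [abs_div, abs_of_pos hε]
  refine div_le_div_of_nonneg_right ?_ hε.le
  rw [abs_le]
  constructor <;> linarith [Real.neg_pi_div_two_lt_arctan (ε * x), Real.arctan_lt_pi_div_two (ε * x),
    Real.pi_le_four]

lemma trunc_nonneg {ε x : ℝ} (hε : 0 < ε) (hx : 0 ≤ x) : 0 ≤ trunc ε x :=
  div_nonneg (Real.arctan_nonneg.2 (by positivity)) hε.le

lemma continuous_trunc (ε : ℝ) : Continuous (trunc ε) := by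
  unfold trunc; fun_prop

lemma continuous_trunc' (ε : ℝ) : Continuous (trunc' ε) := by
  unfold trunc'
  exact continuous_const.div (by fun_prop) fun x => by positivity

lemma continuous_trunc'' (ε : ℝ) : Continuous (trunc'' ε) := by
  unfold trunc''
  exact Continuous.div (by fun_prop) (by fun_prop) fun x => by positivity

/-- The second derivative of `trunc ε ^ (n + 1)`. -/
def truncPow'' (n : ℕ) (ε x : ℝ) : ℝ :=
  (n + 1) * (n * trunc ε x ^ (n - 1) * trunc' ε x ^ 2 + trunc ε x ^ n * trunc'' ε x)

lemma isTestFun_trunc_pow {ε : ℝ} (hε : 0 < ε) (n : ℕ) :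
    IsTestFun (fun x => trunc ε x ^ (n + 1)) (fun x => (n + 1) * (trunc ε x ^ n * trunc' ε x))
      (truncPow'' n ε) where
  contDiff := by
    have : ContDiff ℝ 2 (trunc ε) := by
      unfold trunc
      exact (Real.contDiff_arctan.comp (contDiff_const.mul contDiff_id)).div_const ε
    exact this.pow _
  hasDerivAt x := by
    refine ((hasDerivAt_trunc hε x).pow (n + 1)).congr_deriv ?_
    push_cast
    ring
  hasDerivAt' x := by
    refine ((((hasDerivAt_trunc hε x).pow n).mul (hasDerivAt_trunc' ε x)).const_mul
      ((n : ℝ) + 1)).congr_deriv ?_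
    simp only [truncPow'', Pi.pow_apply]
    ring
  continuous'' := by
    have := continuous_trunc ε
    have := continuous_trunc' ε
    have := continuous_trunc'' ε
    unfold truncPow''
    fun_prop
  bounded := by
    set D := 2 / ε with hD
    have hD0 : 0 ≤ D := by positivity
    have hT : ∀ x m, |trunc ε x ^ m| ≤ D ^ m := fun x m => by
      rw [abs_pow]
      exact pow_le_pow_left₀ (abs_nonneg _) (abs_trunc_le' hε x) m
    have hT' : ∀ x, |trunc' ε x| ≤ 1 := fun x => by
      rw [abs_of_pos (trunc'_pos ε x)]; exact trunc'_le_one ε x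
    have hT'' : ∀ x, |trunc'' ε x| ≤ ε := fun x =>
      (abs_trunc''_le hε x).trans (by nlinarith [trunc'_le_one ε x])
    refine ⟨D ^ (n + 1) + (n + 1) * (D ^ n * 1) + (n + 1) * (n * D ^ (n - 1) * 1 + D ^ n * ε),
      fun x => ⟨?_, ?_, ?_⟩⟩
    · refine (hT x _).trans ?_
      rw [add_assoc]
      exact le_add_of_nonneg_right (by positivity)
    · have : |((n : ℝ) + 1) * (trunc ε x ^ n * trunc' ε x)| ≤ (n + 1) * (D ^ n * 1) :=
        abs_mul_le_mul (abs_of_nonneg (by positivity)).le (abs_mul_le_mul (hT x n) (hT' x))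
      refine this.trans ?_
      rw [add_assoc, add_left_comm]
      exact le_add_of_nonneg_right (by positivity)
    · have : |truncPow'' n ε x| ≤ (n + 1) * (n * D ^ (n - 1) * 1 + D ^ n * ε) := by
        refine abs_mul_le_mul (abs_of_nonneg (by positivity)).le ((abs_add_le _ _).trans
          (add_le_add (abs_mul_le_mul (abs_mul_le_mul (abs_of_nonneg (by positivity)).le
            (hT x _)) ?_) (abs_mul_le_mul (hT x _) (hT'' x))))
        rw [abs_pow]
        exact pow_le_one₀ (abs_nonneg _) (hT' x)
      refine this.trans ?_
      exact le_add_of_nonneg_left (by positivity)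

lemma tendsto_trunc {ε : ℕ → ℝ} (hε : ∀ m, 0 < ε m) (h0 : Tendsto ε atTop (nhds 0)) (x : ℝ) :
    Tendsto (fun m => trunc (ε m) x) atTop (nhds x) := by
  have h : HasDerivAt (fun t => Real.arctan (t * x)) x 0 := by
    have := ((hasDerivAt_id (0 : ℝ)).mul_const x).arctan
    simpa using this
  have h1 := h.tendsto_slope_zero
  have h2 : Tendsto ε atTop (nhdsWithin 0 {0}ᶜ) :=
    tendsto_nhdsWithin_iff.2 ⟨h0, Eventually.of_forall fun m => (hε m).ne'⟩
  refine (h1.comp h2).congr fun m => ?_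
  simp [trunc, div_eq_inv_mul]

lemma tendsto_trunc' {ε : ℕ → ℝ} (h0 : Tendsto ε atTop (nhds 0)) (x : ℝ) :
    Tendsto (fun m => trunc' (ε m) x) atTop (nhds 1) := by
  have hc : Continuous fun t : ℝ => trunc' t x := by
    unfold trunc'
    exact continuous_const.div (by fun_prop) fun x => by positivity
  have := (hc.tendsto 0).comp h0
  simpa [trunc', Function.comp_def] using this

lemma integrable_and_integral_le_of_tendsto {X : Type*} [MeasurableSpace X] {μ : Measure X}
    {F : ℕ → X → ℝ} {G : X → ℝ} {C : ℝ} (hF : ∀ m, Integrable (F m) μ)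
    (hF0 : ∀ m, 0 ≤ᵐ[μ] F m) (hle : ∀ m, ∫ x, F m x ∂μ ≤ C)
    (hlim : ∀ᵐ x ∂μ, Tendsto (fun m => F m x) atTop (nhds (G x))) :
    Integrable G μ ∧ ∫ x, G x ∂μ ≤ C := by
  have hC : 0 ≤ C := (integral_nonneg_of_ae (hF0 0)).trans (hle 0)
  have hGm : AEStronglyMeasurable G μ :=
    aestronglyMeasurable_of_tendsto_ae atTop (fun m => (hF m).1) hlim
  have hG0 : 0 ≤ᵐ[μ] G := by
    filter_upwards [hlim, ae_all_iff.2 hF0] with x hx hx0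
    exact ge_of_tendsto' hx hx0
  have hl : ∫⁻ x, ENNReal.ofReal (G x) ∂μ ≤ ENNReal.ofReal C := by
    calc ∫⁻ x, ENNReal.ofReal (G x) ∂μ
        = ∫⁻ x, liminf (fun m => ENNReal.ofReal (F m x)) atTop ∂μ := by
          refine lintegral_congr_ae ?_
          filter_upwards [hlim] with x hx
          exact ((ENNReal.tendsto_ofReal hx).liminf_eq).symm
      _ ≤ liminf (fun m => ∫⁻ x, ENNReal.ofReal (F m x) ∂μ) atTop :=
          lintegral_liminf_le' fun m => (hF m).1.aemeasurable.ennreal_ofReal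
      _ ≤ ENNReal.ofReal C := by
          refine liminf_le_of_le (by isBoundedDefault) fun b hb => ?_
          obtain ⟨m, hm⟩ := hb.exists
          refine hm.trans ?_
          rw [← ofReal_integral_eq_lintegral_ofReal (hF m) (hF0 m)]
          exact ENNReal.ofReal_le_ofReal (hle m)
  refine ⟨⟨hGm, ?_⟩, ?_⟩
  · rw [hasFiniteIntegral_iff_ofReal hG0]
    exact hl.trans_lt ENNReal.ofReal_lt_top
  · rw [integral_eq_lintegral_of_nonneg_ae hG0 hGm]
    exact ENNReal.toReal_le_of_le_ofReal hC hl

lemma pow_le_one_add_pow {x : ℝ} (hx : 0 ≤ x) {m n : ℕ} (h : m ≤ n) : x ^ m ≤ 1 + x ^ n := by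
  rcases le_total x 1 with h1 | h1
  · exact (pow_le_one₀ hx h1).trans (le_add_of_nonneg_right (by positivity))
  · exact (pow_le_pow_right₀ h1 h).trans (le_add_of_nonneg_left zero_le_one)

lemma abs_trunc_pow_le {ε : ℝ} (hε : 0 < ε) (n : ℕ) (x : ℝ) : |trunc ε x ^ n| ≤ |x| ^ n := by
  rw [abs_pow]
  exact pow_le_pow_left₀ (abs_nonneg _) (abs_trunc_le hε x) n

lemma abs_trunc_pow_mul_trunc'_le {ε : ℝ} (hε : 0 < ε) (n : ℕ) (x : ℝ) :
    |trunc ε x ^ n * trunc' ε x| ≤ |x| ^ n := by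
  have := abs_mul_le_mul (abs_trunc_pow_le hε n x)
    ((abs_of_pos (trunc'_pos ε x)).trans_le (trunc'_le_one ε x))
  simpa using this

lemma abs_truncPow''_le_mul {ε : ℝ} (hε : 0 < ε) (n : ℕ) (x : ℝ) :
    |truncPow'' n ε x| ≤
      (n + 1) * ((n * |trunc ε x| ^ (n - 1) + ε * |trunc ε x| ^ n) * trunc' ε x) := by
  have h0 := trunc'_pos ε x
  have h1 := trunc'_le_one ε x
  refine abs_mul_le_mul (abs_of_nonneg (by positivity)).le ((abs_add_le _ _).trans ?_)
  rw [add_mul]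
  refine add_le_add ?_ ?_
  · rw [abs_mul, abs_mul, abs_pow, abs_pow, abs_of_pos h0, Nat.abs_cast]
    refine mul_le_mul_of_nonneg_left ?_ (by positivity)
    nlinarith
  · rw [abs_mul, abs_pow]
    calc _ ≤ |trunc ε x| ^ n * (ε * trunc' ε x) :=
          mul_le_mul_of_nonneg_left (abs_trunc''_le hε x) (by positivity)
      _ = _ := by ring

lemma abs_truncPow''_le {ε : ℝ} (hε : 0 < ε) (hε1 : ε ≤ 1) (n : ℕ) (x : ℝ) :
    |truncPow'' n ε x| ≤ (n + 1) ^ 2 * (1 + |x| ^ (n + 1)) := by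
  refine (abs_truncPow''_le_mul hε n x).trans ?_
  rw [pow_two, mul_assoc]
  refine mul_le_mul_of_nonneg_left ?_ (by positivity)
  have hT : ∀ m ≤ n + 1, |trunc ε x| ^ m ≤ 1 + |x| ^ (n + 1) := fun m hm =>
    (pow_le_pow_left₀ (abs_nonneg _) (abs_trunc_le hε x) m).trans
      (pow_le_one_add_pow (abs_nonneg x) hm)
  calc _ ≤ (n * |trunc ε x| ^ (n - 1) + ε * |trunc ε x| ^ n) * 1 :=
        mul_le_mul_of_nonneg_left (trunc'_le_one ε x) (by positivity)
    _ ≤ n * (1 + |x| ^ (n + 1)) + 1 * (1 + |x| ^ (n + 1)) := by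
        rw [mul_one]
        refine add_le_add (mul_le_mul_of_nonneg_left (hT _ (by omega)) (by positivity)) ?_
        exact mul_le_mul hε1 (hT _ (by omega)) (by positivity) zero_le_one
    _ = _ := by ring

lemma exists_mul_pow_pred_le (n : ℕ) {δ : ℝ} (hδ : 0 < δ) :
    ∃ C, 0 ≤ C ∧ ∀ t : ℝ, 0 ≤ t → n * t ^ (n - 1) ≤ δ * t ^ n + C := by
  rcases n with _ | n
  · exact ⟨0, le_rfl, fun t ht => by simp [hδ.le]⟩
  · refine ⟨(n + 1) * ((n + 1) / δ) ^ n, by positivity, fun t ht => ?_⟩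
    simp only [Nat.add_sub_cancel, Nat.cast_add, Nat.cast_one]
    rcases le_total ((n + 1) / δ) t with h | h
    · rw [div_le_iff₀ hδ] at h
      have : (n + 1) * t ^ n ≤ δ * t ^ (n + 1) := by
        rw [pow_succ]
        nlinarith [mul_le_mul_of_nonneg_right h (pow_nonneg ht n)]
      exact this.trans (le_add_of_nonneg_right (by positivity))
    · refine le_trans ?_ (le_add_of_nonneg_left (by positivity))
      exact mul_le_mul_of_nonneg_left (pow_le_pow_left₀ ht h n) (by positivity)

lemma exists_abs_truncPow''_le {n : ℕ} (hn : Even n) {δ : ℝ} (hδ : 0 < δ) :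
    ∃ C, 0 ≤ C ∧ ∀ ε, 0 < ε → ε ≤ δ / 2 → ∀ x,
      |truncPow'' n ε x| ≤ δ * ((n + 1) * (trunc ε x ^ n * trunc' ε x)) + C := by
  obtain ⟨C, hC0, hC⟩ := exists_mul_pow_pred_le n (half_pos hδ)
  refine ⟨(n + 1) * C, by positivity, fun ε hε hεδ x => ?_⟩
  refine (abs_truncPow''_le_mul hε n x).trans ?_
  have h1 := hC |trunc ε x| (abs_nonneg _)
  have hx : 0 ≤ |trunc ε x| ^ n := by positivity
  have h2 : n * |trunc ε x| ^ (n - 1) + ε * |trunc ε x| ^ n ≤ δ * |trunc ε x| ^ n + C := by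
    nlinarith
  rw [← hn.pow_abs (trunc ε x)]
  calc _ ≤ ((n : ℝ) + 1) * ((δ * |trunc ε x| ^ n + C) * trunc' ε x) :=
        mul_le_mul_of_nonneg_left (mul_le_mul_of_nonneg_right h2 (trunc'_pos ε x).le)
          (by positivity)
    _ = δ * ((n + 1) * (|trunc ε x| ^ n * trunc' ε x)) + ((n + 1) * C) * trunc' ε x := by ring
    _ ≤ _ := by
        refine add_le_add le_rfl ?_
        exact mul_le_of_le_one_right (by positivity) (trunc'_le_one ε x)

/-- The integrals `∫ F r ∂(μ r)` exist and are bounded above uniformly in `r ∈ (0,1)`. -/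
def UnifIntegralBdd {X : Type*} [MeasurableSpace X] (μ : ℝ → Measure X) (F : ℝ → X → ℝ) : Prop :=
  ∃ C, ∀ r ∈ Set.Ioo (0 : ℝ) 1, Integrable (F r) (μ r) ∧ ∫ z, F r z ∂(μ r) ≤ C

namespace UnifIntegralBdd

variable {X : Type*} [MeasurableSpace X] {μ : ℝ → Measure X} {F G : ℝ → X → ℝ}

lemma add (hF : UnifIntegralBdd μ F) (hG : UnifIntegralBdd μ G) :
    UnifIntegralBdd μ (fun r z => F r z + G r z) := by
  obtain ⟨C, hC⟩ := hF
  obtain ⟨D, hD⟩ := hG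
  refine ⟨C + D, fun r hr => ⟨(hC r hr).1.add (hD r hr).1, ?_⟩⟩
  rw [integral_add (hC r hr).1 (hD r hr).1]
  exact add_le_add (hC r hr).2 (hD r hr).2

lemma const_mul (hF : UnifIntegralBdd μ F) {c : ℝ} (hc : 0 ≤ c) :
    UnifIntegralBdd μ (fun r z => c * F r z) := by
  obtain ⟨C, hC⟩ := hF
  refine ⟨c * C, fun r hr => ⟨(hC r hr).1.const_mul c, ?_⟩⟩
  rw [integral_const_mul]
  exact mul_le_mul_of_nonneg_left (hC r hr).2 hc

lemma const (hμ : ∀ r ∈ Set.Ioo (0 : ℝ) 1, IsProbabilityMeasure (μ r)) (c : ℝ) :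
    UnifIntegralBdd μ (fun _ _ => c) := by
  refine ⟨c, fun r hr => ?_⟩
  have := hμ r hr
  exact ⟨integrable_const c, by simp⟩

lemma mono (hG : UnifIntegralBdd μ G)
    (hF : ∀ r ∈ Set.Ioo (0 : ℝ) 1, AEStronglyMeasurable (F r) (μ r))
    (h : ∀ r ∈ Set.Ioo (0 : ℝ) 1, ∀ᵐ z ∂(μ r), |F r z| ≤ G r z) : UnifIntegralBdd μ F := by
  obtain ⟨C, hC⟩ := hG
  refine ⟨C, fun r hr => ?_⟩
  have hi : Integrable (F r) (μ r) := (hC r hr).1.mono' (hF r hr) (h r hr)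
  refine ⟨hi, (integral_mono_ae hi (hC r hr).1 ?_).trans (hC r hr).2⟩
  filter_upwards [h r hr] with z hz using (le_abs_self _).trans hz

end UnifIntegralBdd

section

variable {d : ℕ} {Γ R : Matrix (Fin d) (Fin d) ℝ} {π : ℝ → Measure (Fin d → ℝ)}
  {ν : Fin d → ℝ → Measure (Fin d → ℝ)}

lemma isClosed_posOrthant (d : ℕ) : IsClosed (posOrthant d) := by
  have : posOrthant d = ⋂ i, {z : Fin d → ℝ | 0 ≤ z i} := by ext; simp [posOrthant]
  rw [this]
  exact isClosed_iInter fun i => isClosed_le continuous_const (continuous_apply i)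

lemma BARFamily.ae_pi (h : BARFamily Γ R π ν) {r : ℝ} (hr : r ∈ Set.Ioo (0 : ℝ) 1) :
    ∀ᵐ z ∂(π r), ∀ i, 0 ≤ z i := by
  obtain ⟨hp, h1, -, -⟩ := h r hr
  exact (mem_ae_iff_prob_eq_one (isClosed_posOrthant d).measurableSet).2 h1

lemma BARFamily.ae_nu (h : BARFamily Γ R π ν) {r : ℝ} (hr : r ∈ Set.Ioo (0 : ℝ) 1) (i : Fin d) :
    ∀ᵐ z ∂(ν i r), (∀ j, 0 ≤ z j) ∧ z i = 0 := by
  obtain ⟨-, -, hν, -⟩ := h r hr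
  obtain ⟨hp, h1⟩ := hν i
  have hc : IsClosed {z | z ∈ posOrthant d ∧ z i = 0} :=
    (isClosed_posOrthant d).inter (isClosed_eq (continuous_apply i) continuous_const)
  exact (mem_ae_iff_prob_eq_one hc.measurableSet).2 h1

lemma abs_sum_sum_mul_le (Γ : Matrix (Fin d) (Fin d) ℝ) {c : Fin d → Fin d → ℝ} {M : ℝ}
    (hc : ∀ i j, |c i j| ≤ M) : |∑ i, ∑ j, Γ i j * c i j| ≤ M * ∑ i, ∑ j, |Γ i j| := by
  rw [Finset.mul_sum]
  refine (Finset.abs_sum_le_sum_abs _ _).trans (Finset.sum_le_sum fun i _ => ?_)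
  rw [Finset.mul_sum]
  refine (Finset.abs_sum_le_sum_abs _ _).trans (Finset.sum_le_sum fun j _ => ?_)
  rw [abs_mul, mul_comm]
  exact mul_le_mul_of_nonneg_right (hc i j) (abs_nonneg _)

lemma uR_single (R : Matrix (Fin d) (Fin d) ℝ) (i j : Fin d) (c : ℝ) :
    uR R (Pi.single i c) j = c * R i j := by
  simp [uR, Pi.single_apply]

lemma abs_single_le {c M : ℝ} (hc : |c| ≤ M) (i j : Fin d) :
    |(Pi.single i c : Fin d → ℝ) j| ≤ M := by
  rw [Pi.single_apply]
  split_ifs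
  · exact hc
  · simpa using (abs_nonneg c).trans hc

lemma abs_integral_le_mul {X : Type*} [MeasurableSpace X] {μ : Measure X} {f W : X → ℝ} {c P : ℝ}
    (hc : 0 ≤ c) (hW : Integrable W μ) (hP : ∫ z, W z ∂μ ≤ P) (h : ∀ᵐ z ∂μ, |f z| ≤ c * W z) :
    |∫ z, f z ∂μ| ≤ c * P := by
  refine (norm_integral_le_of_norm_le (f := f) (hW.const_mul c) h).trans ?_
  rw [integral_const_mul]
  exact mul_le_mul_of_nonneg_left hP hc

/-- The rescaled coordinate moments under `ν i r`, weighted by `r ^ i`, are uniformly bounded as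
soon as those under `π r` are. -/
lemma unifIntegralBdd_nu (h : BARFamily Γ R π ν) (hdiag : ∀ i, 0 < R i i)
    (htri : ∀ i j : Fin d, i < j → R i j = 0) (k : Fin d)
    (hπ : ∀ n : ℕ, UnifIntegralBdd π (fun r z => (r ^ ((k : ℕ) + 1) * z k) ^ n)) (n : ℕ) :
    ∀ i, UnifIntegralBdd (ν i)
      (fun r z => r ^ (i : ℕ) * (r ^ ((k : ℕ) + 1) * z k) ^ n) := by
  induction n with
  | zero =>
    intro i
    refine (UnifIntegralBdd.const (μ := ν i) (fun r hr => ((h r hr).2.2.1 i).1) 1).mono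
      (fun r hr => Continuous.aestronglyMeasurable (by fun_prop)) fun r hr => Eventually.of_forall fun z => ?_
    rw [pow_zero, mul_one, abs_of_nonneg (pow_nonneg hr.1.le _)]
    exact pow_le_one₀ hr.1.le hr.2.le
  | succ n ihn =>
    intro i
    induction i using WellFoundedLT.induction with
    | ind i ihi =>
    set W : ℝ → (Fin d → ℝ) → ℝ := fun r z =>
      (n + 1) ^ 2 * (1 + (r ^ ((k : ℕ) + 1) * z k) ^ (n + 1)) with hWdef
    have hWb : UnifIntegralBdd π W :=
      ((UnifIntegralBdd.const (fun r hr => (h r hr).1) 1).add (hπ (n + 1))).const_mul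
        (by positivity)
    obtain ⟨P, hP⟩ := hWb
    -- contribution of each boundary measure
    have hbd : ∀ j : Fin d, ∃ D, ∀ r ∈ Set.Ioo (0 : ℝ) 1, ∀ ε, 0 < ε → ε ≤ 1 →
        |r ^ ((j : ℕ) + 1) * (∫ z, r * R i j * (Real.cos (r * z i)
              * trunc ε (r ^ ((k : ℕ) + 1) * z k) ^ (n + 1))
            + r ^ ((k : ℕ) + 1) * R k j * (Real.sin (r * z i) *
              ((n + 1) * (trunc ε (r ^ ((k : ℕ) + 1) * z k) ^ n
                * trunc' ε (r ^ ((k : ℕ) + 1) * z k)))) ∂(ν j r))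
          - (if j = i then r ^ ((i : ℕ) + 2) * R i i *
              ∫ z, trunc ε (r ^ ((k : ℕ) + 1) * z k) ^ (n + 1) ∂(ν i r) else 0)|
          ≤ r ^ 2 * D := by
      intro j
      by_cases hji : j = i
      · subst hji
        refine ⟨0, fun r hr ε hε hε1 => ?_⟩
        have : ∫ z, r * R j j * (Real.cos (r * z j)
              * trunc ε (r ^ ((k : ℕ) + 1) * z k) ^ (n + 1))
            + r ^ ((k : ℕ) + 1) * R k j * (Real.sin (r * z j) *
              ((n + 1) * (trunc ε (r ^ ((k : ℕ) + 1) * z k) ^ n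
                * trunc' ε (r ^ ((k : ℕ) + 1) * z k)))) ∂(ν j r)
            = r * R j j * ∫ z, trunc ε (r ^ ((k : ℕ) + 1) * z k) ^ (n + 1) ∂(ν j r) := by
          rw [← integral_const_mul]
          refine integral_congr_ae ?_
          filter_upwards [h.ae_nu hr j] with z hz
          simp [hz.2]
        rw [this, if_pos rfl]
        refine le_of_eq ?_
        rw [mul_zero, abs_eq_zero]
        ring
      · have hR : UnifIntegralBdd (ν j) (fun r z => |R i j| *
            (r ^ (j : ℕ) * (r ^ ((k : ℕ) + 1) * z k) ^ (n + 1))) := by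
          rcases lt_or_gt_of_ne hji with hlt | hgt
          · exact (ihi j hlt).const_mul (abs_nonneg _)
          · simpa [htri i j hgt] using
              UnifIntegralBdd.const (μ := ν j) (fun r hr => ((h r hr).2.2.1 j).1) 0
        obtain ⟨D, hD⟩ := hR.add ((ihn j).const_mul (c := |R k j| * (n + 1)) (by positivity))
        refine ⟨D, fun r hr ε hε hε1 => ?_⟩
        rw [if_neg hji, sub_zero, ← integral_const_mul]
        refine abs_integral_le_mul (sq_nonneg r) (hD r hr).1 (hD r hr).2 ?_
        filter_upwards [h.ae_nu hr j] with z hz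
        have hr0 := hr.1.le
        set Y := r ^ ((k : ℕ) + 1) * z k with hY
        have hY0 : 0 ≤ Y := mul_nonneg (pow_nonneg hr0 _) (hz.1 k)
        have b1 : |Real.cos (r * z i) * trunc ε Y ^ (n + 1)| ≤ 1 * Y ^ (n + 1) :=
          abs_mul_le_mul (Real.abs_cos_le_one _)
            ((abs_trunc_pow_le hε _ _).trans_eq (by rw [abs_of_nonneg hY0]))
        have b2 : |Real.sin (r * z i) * ((n + 1) * (trunc ε Y ^ n * trunc' ε Y))|
            ≤ 1 * ((n + 1) * Y ^ n) :=
          abs_mul_le_mul (Real.abs_sin_le_one _) (abs_mul_le_mul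
            (abs_of_nonneg (by positivity)).le
            ((abs_trunc_pow_mul_trunc'_le hε _ _).trans_eq (by rw [abs_of_nonneg hY0])))
        have b3 : |r * R i j| ≤ r * |R i j| := by rw [abs_mul, abs_of_nonneg hr0]
        have b4 : |r ^ ((k : ℕ) + 1) * R k j| ≤ r * |R k j| := by
          rw [abs_mul, abs_of_nonneg (pow_nonneg hr0 _)]
          exact mul_le_mul_of_nonneg_right
            (pow_le_of_le_one hr0 hr.2.le (Nat.succ_ne_zero _)) (abs_nonneg _)
        have b5 := (abs_add_le _ _).trans
          (add_le_add (abs_mul_le_mul b3 b1) (abs_mul_le_mul b4 b2))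
        rw [abs_mul, abs_of_nonneg (pow_nonneg hr0 _)]
        refine (mul_le_mul_of_nonneg_left b5 (pow_nonneg hr0 _)).trans_eq ?_
        ring
    choose D hD using hbd
    set S : ℝ := ∑ p, ∑ q, |Γ p q| with hS
    set K : ℝ := (2 * S * P + ∑ j, (|R i j| + |R k j|) * P + ∑ j, D j) / R i i with hK
    have key : ∀ r ∈ Set.Ioo (0 : ℝ) 1, ∀ ε, 0 < ε → ε ≤ 1 →
        r ^ (i : ℕ) * ∫ z, trunc ε (r ^ ((k : ℕ) + 1) * z k) ^ (n + 1) ∂(ν i r) ≤ K := by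
      intro r hr ε hε hε1
      have hr0 := hr.1.le
      have hbar := (h r hr).2.2.2.mul isTestFun_sin (isTestFun_trunc_pow hε n)
        (Pi.single i r) (Pi.single k (r ^ ((k : ℕ) + 1)))
      simp only [dotL_smul_single, uR_single] at hbar
      have hrk : |r ^ ((k : ℕ) + 1)| ≤ r := by
        rw [abs_of_nonneg (pow_nonneg hr0 _)]
        exact pow_le_of_le_one hr0 hr.2.le (Nat.succ_ne_zero _)
      have hri : |r| ≤ r := (abs_of_nonneg hr0).le
      set a : Fin d → ℝ := Pi.single i r with ha
      set b : Fin d → ℝ := Pi.single k (r ^ ((k : ℕ) + 1)) with hb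
      have haj : ∀ j, |a j| ≤ r := abs_single_le hri i
      have hbj : ∀ j, |b j| ≤ r := abs_single_le hrk k
      have haa := abs_sum_sum_mul_le Γ fun p q => abs_mul_le_mul (haj p) (haj q)
      have hbb := abs_sum_sum_mul_le Γ fun p q => abs_mul_le_mul (hbj p) (hbj q)
      have hab := abs_sum_sum_mul_le Γ (c := fun p q => a p * b q + b p * a q) fun p q =>
        (abs_add_le _ _).trans
          (add_le_add (abs_mul_le_mul (haj p) (hbj q)) (abs_mul_le_mul (hbj p) (haj q)))
      have hB : ∀ᵐ z ∂(π r), |trunc ε (r ^ ((k : ℕ) + 1) * z k) ^ (n + 1)| ≤ W r z ∧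
          |((n : ℝ) + 1) * (trunc ε (r ^ ((k : ℕ) + 1) * z k) ^ n
            * trunc' ε (r ^ ((k : ℕ) + 1) * z k))| ≤ W r z ∧
          |truncPow'' n ε (r ^ ((k : ℕ) + 1) * z k)| ≤ W r z := by
        filter_upwards [h.ae_pi hr] with z hz
        simp only [hWdef]
        set Y := r ^ ((k : ℕ) + 1) * z k with hY
        have hY0 : 0 ≤ Y := mul_nonneg (pow_nonneg hr0 _) (hz k)
        have hYn : 0 ≤ Y ^ (n + 1) := pow_nonneg hY0 _
        have hn : (0 : ℝ) ≤ n := Nat.cast_nonneg n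
        refine ⟨?_, ?_, ?_⟩
        · refine (abs_trunc_pow_le hε _ _).trans ?_
          rw [abs_of_nonneg hY0]
          nlinarith [mul_nonneg hn hYn, mul_nonneg (mul_nonneg hn hn) hYn]
        · have := abs_mul_le_mul (abs_of_nonneg (by positivity : 0 ≤ (n : ℝ) + 1)).le
            (abs_trunc_pow_mul_trunc'_le hε n Y)
          refine this.trans ?_
          rw [abs_of_nonneg hY0, pow_two, mul_assoc]
          refine mul_le_mul_of_nonneg_left ?_ (by positivity)
          refine (pow_le_one_add_pow hY0 (Nat.le_add_right n 1)).trans ?_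
          nlinarith [mul_nonneg hn hYn]
        · refine (abs_truncPow''_le hε hε1 n Y).trans_eq ?_
          rw [abs_of_nonneg hY0]
      have hπ2 := abs_integral_le_mul (c := 4 * (r ^ 2 * S)) (by positivity) (hP r hr).1
        (hP r hr).2 (f := fun z => (∑ p, ∑ q, Γ p q * (a p * a q)) * (-Real.sin (r * z i)
            * trunc ε (r ^ ((k : ℕ) + 1) * z k) ^ (n + 1))
          + (∑ p, ∑ q, Γ p q * (a p * b q + b p * a q)) * (Real.cos (r * z i)
            * ((n + 1) * (trunc ε (r ^ ((k : ℕ) + 1) * z k) ^ n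
              * trunc' ε (r ^ ((k : ℕ) + 1) * z k))))
          + (∑ p, ∑ q, Γ p q * (b p * b q)) * (Real.sin (r * z i)
            * truncPow'' n ε (r ^ ((k : ℕ) + 1) * z k))) (by
          filter_upwards [hB] with z hz
          refine ((abs_add_three _ _ _).trans (add_le_add (add_le_add
            (abs_mul_le_mul haa (abs_mul_le_mul
              ((abs_neg _).trans_le (Real.abs_sin_le_one _)) hz.1))
            (abs_mul_le_mul hab (abs_mul_le_mul (Real.abs_cos_le_one _) hz.2.1)))
            (abs_mul_le_mul hbb (abs_mul_le_mul (Real.abs_sin_le_one _) hz.2.2)))).trans_eq ?_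
          ring)
      have hπ1 : ∀ j : Fin d, |r ^ ((j : ℕ) + 1) * ∫ z, r * R i j * (Real.cos (r * z i)
              * trunc ε (r ^ ((k : ℕ) + 1) * z k) ^ (n + 1))
            + r ^ ((k : ℕ) + 1) * R k j * (Real.sin (r * z i) *
              ((n + 1) * (trunc ε (r ^ ((k : ℕ) + 1) * z k) ^ n
                * trunc' ε (r ^ ((k : ℕ) + 1) * z k)))) ∂(π r)|
          ≤ r ^ 2 * ((|R i j| + |R k j|) * P) := by
        intro j
        rw [← integral_const_mul, ← mul_assoc]
        refine abs_integral_le_mul (by positivity) (hP r hr).1 (hP r hr).2 ?_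
        filter_upwards [hB] with z hz
        have hrj : |r ^ ((j : ℕ) + 1)| ≤ r := by
          rw [abs_of_nonneg (pow_nonneg hr0 _)]
          exact pow_le_of_le_one hr0 hr.2.le (Nat.succ_ne_zero _)
        refine (abs_mul_le_mul hrj ((abs_add_le _ _).trans (add_le_add
          (abs_mul_le_mul (abs_mul_le_mul hri le_rfl)
            (abs_mul_le_mul (Real.abs_cos_le_one _) hz.1))
          (abs_mul_le_mul (abs_mul_le_mul hrk le_rfl)
            (abs_mul_le_mul (Real.abs_sin_le_one _) hz.2.1))))).trans_eq ?_
        ring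
      have s1 := Finset.sum_le_sum fun j (_ : j ∈ Finset.univ) => (abs_le.1 (hπ1 j)).2
      have s2 := Finset.sum_le_sum fun j (_ : j ∈ Finset.univ) =>
        (abs_le.1 (hD j r hr ε hε hε1)).1
      rw [← Finset.mul_sum] at s1
      rw [Finset.sum_neg_distrib, ← Finset.mul_sum, Finset.sum_sub_distrib,
        Finset.sum_ite_eq' Finset.univ i, if_pos (Finset.mem_univ i)] at s2
      have s3 := (abs_le.1 hπ2).1
      have hfin : r ^ 2 * (R i i * (r ^ (i : ℕ) *
            ∫ z, trunc ε (r ^ ((k : ℕ) + 1) * z k) ^ (n + 1) ∂(ν i r)))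
          ≤ r ^ 2 * (2 * S * P + ∑ j, (|R i j| + |R k j|) * P + ∑ j, D j) := by
        have e : r ^ 2 * (R i i * (r ^ (i : ℕ) *
            ∫ z, trunc ε (r ^ ((k : ℕ) + 1) * z k) ^ (n + 1) ∂(ν i r)))
          = r ^ ((i : ℕ) + 2) * R i i *
            ∫ z, trunc ε (r ^ ((k : ℕ) + 1) * z k) ^ (n + 1) ∂(ν i r) := by ring
        rw [e]
        linarith
      have := le_of_mul_le_mul_left hfin (pow_pos hr.1 2)
      rw [hK, le_div_iff₀ (hdiag i)]
      linarith
    refine ⟨K, fun r hr => ?_⟩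
    have hpr := ((h r hr).2.2.1 i).1
    have hr0 := hr.1.le
    refine integrable_and_integral_le_of_tendsto (F := fun m z => r ^ (i : ℕ) *
      trunc (1 / ((m : ℝ) + 1)) (r ^ ((k : ℕ) + 1) * z k) ^ (n + 1)) ?_ ?_ ?_ ?_
    · intro m
      obtain ⟨C, hC⟩ := (isTestFun_trunc_pow (Nat.one_div_pos_of_nat (α := ℝ) (n := m)) n).bounded
      refine (Integrable.of_bound ?_ C (Eventually.of_forall fun z => (hC _).1)).const_mul _
      have := continuous_trunc (1 / ((m : ℝ) + 1))
      exact (Continuous.aestronglyMeasurable (by fun_prop))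
    · intro m
      filter_upwards [h.ae_nu hr i] with z hz
      exact mul_nonneg (pow_nonneg hr0 _) (pow_nonneg (trunc_nonneg Nat.one_div_pos_of_nat
        (mul_nonneg (pow_nonneg hr0 _) (hz.1 k))) _)
    · intro m
      rw [integral_const_mul]
      refine key r hr _ Nat.one_div_pos_of_nat ?_
      rw [div_le_one (by positivity)]
      exact le_add_of_nonneg_left (Nat.cast_nonneg m)
    · exact Eventually.of_forall fun z => ((tendsto_trunc (fun m => Nat.one_div_pos_of_nat)
        tendsto_one_div_add_atTop_nhds_zero_nat _).pow _).const_mul _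

lemma integrable_trunc_pow_mul_trunc' {X : Type*} [TopologicalSpace X] [MeasurableSpace X]
    [OpensMeasurableSpace X] {μ : Measure X} [IsFiniteMeasure μ] {ε : ℝ} (hε : 0 < ε) (n : ℕ)
    {Y : X → ℝ} (hY : Continuous Y) :
    Integrable (fun z => trunc ε (Y z) ^ n * trunc' ε (Y z)) μ := by
  obtain ⟨D, hD⟩ := (isTestFun_trunc_pow hε n).bounded
  have h1 := continuous_trunc ε
  have h2 := continuous_trunc' ε
  refine Integrable.of_bound (Continuous.aestronglyMeasurable (by fun_prop)) D
    (Eventually.of_forall fun z => le_trans ?_ (hD (Y z)).2.1)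
  rw [Real.norm_eq_abs, abs_mul ((n : ℝ) + 1)]
  refine le_mul_of_one_le_left (abs_nonneg _) ?_
  rw [abs_of_nonneg (by positivity)]
  exact le_add_of_nonneg_left (Nat.cast_nonneg n)

/-- Even moments of `r ^ (k + 1) * ⟨v, z⟩`, where `vᵀ R = e_kᵀ`, are uniformly bounded under `π r`
as soon as they are under `ν k r`. -/
lemma unifIntegralBdd_pi_dotL (h : BARFamily Γ R π ν) {k : Fin d} {v : Fin d → ℝ}
    (hv : ∀ j, uR R v j = if j = k then 1 else 0) {n : ℕ} (hn : Even n)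
    (hν : UnifIntegralBdd (ν k) (fun r z => (r ^ ((k : ℕ) + 1) * dotL v z) ^ n)) :
    UnifIntegralBdd π (fun r z => (r ^ ((k : ℕ) + 1) * dotL v z) ^ n) := by
  obtain ⟨N, hN⟩ := hν
  set q : ℝ := ∑ i, ∑ j, Γ i j * (v i * v j) with hq
  set δ : ℝ := 1 / (|q| + 1) with hδ
  have hδ0 : 0 < δ := by positivity
  have hqδ : |q| * δ ≤ 1 := by
    rw [hδ, mul_one_div, div_le_one (by positivity)]
    linarith
  obtain ⟨C, hC0, hC⟩ := exists_abs_truncPow''_le hn hδ0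
  have hn1 : (0 : ℝ) < n + 1 := by positivity
  have key : ∀ r ∈ Set.Ioo (0 : ℝ) 1, ∀ ε, 0 < ε → ε ≤ δ / 2 →
      ∫ z, trunc ε (r ^ ((k : ℕ) + 1) * dotL v z) ^ n
        * trunc' ε (r ^ ((k : ℕ) + 1) * dotL v z) ∂(π r) ≤ |q| * C / (n + 1) + 2 * N := by
    intro r hr ε hε hεδ
    have hpr := (h r hr).1
    set s : ℝ := r ^ ((k : ℕ) + 1) with hs
    have hs0 : 0 < s := pow_pos hr.1 _
    have hbar := (h r hr).2.2.2.mul (isTestFun_trunc_pow hε n) isTestFun_one (s • v) 0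
    have e1 : ∀ j, uR R (s • v) j = s * if j = k then 1 else 0 := fun j => by
      rw [← hv j, uR, uR, Finset.mul_sum]
      simp [mul_assoc]
    have e2 : ∑ i, ∑ j, Γ i j * ((s • v) i * (s • v) j) = s ^ 2 * q := by
      simp only [hq, Finset.mul_sum, Pi.smul_apply, smul_eq_mul]
      exact Finset.sum_congr rfl fun i _ => Finset.sum_congr rfl fun j _ => by ring
    have e3 : ∀ z, dotL (s • v) z = s * dotL v z := fun z => by
      simp [dotL_apply, Finset.mul_sum, mul_assoc]
    rw [e2] at hbar
    simp only [e1, e3, mul_one, mul_zero, add_zero, integral_const_mul] at hbar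
    simp only [mul_ite, ite_mul, mul_one, mul_zero, zero_mul, Finset.sum_ite_eq', Finset.mem_univ,
      if_true] at hbar
    set I := ∫ z, trunc ε (s * dotL v z) ^ n * trunc' ε (s * dotL v z) ∂(π r) with hI
    set J := ∫ z, trunc ε (s * dotL v z) ^ n * trunc' ε (s * dotL v z) ∂(ν k r) with hJ
    set H := ∫ z, truncPow'' n ε (s * dotL v z) ∂(π r) with hH
    have hint := integrable_trunc_pow_mul_trunc' (μ := π r) hε n
      (show Continuous fun z => s * dotL v z by fun_prop)
    have hJN : J ≤ N := by
      refine le_trans ?_ (hN r hr).2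
      have hpν := ((h r hr).2.2.1 k).1
      refine integral_mono (integrable_trunc_pow_mul_trunc' hε n (by fun_prop)) (hN r hr).1
        fun z => ?_
      refine (le_abs_self _).trans ((abs_trunc_pow_mul_trunc'_le hε n _).trans_eq ?_)
      exact hn.pow_abs _
    have hHI : |H| ≤ δ * ((n + 1) * I) + C := by
      have hg := ((hint.const_mul ((n : ℝ) + 1)).const_mul δ).add (integrable_const C)
      refine (norm_integral_le_of_norm_le (f := fun z => truncPow'' n ε (s * dotL v z)) hg
        (Eventually.of_forall fun z => hC ε hε hεδ (s * dotL v z))).trans_eq ?_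
      simp only [Pi.add_apply]
      rw [integral_add ((hint.const_mul _).const_mul _) (integrable_const _),
        integral_const_mul, integral_const_mul]
      simp [hI]
    have hI0 : 0 ≤ I := integral_nonneg fun z => mul_nonneg (hn.pow_nonneg _) (trunc'_pos _ _).le
    have hbar' : s ^ 2 * (1 / 2 * (q * H) - (n + 1) * I + (n + 1) * J) = 0 := by
      rw [← hbar]
      ring
    have hbal := (mul_eq_zero.1 hbar').resolve_left (pow_pos hs0 2).ne'
    have hqH : q * H ≤ (n + 1) * I + |q| * C :=
      calc q * H ≤ |q| * |H| := (le_abs_self _).trans (abs_mul _ _).le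
        _ ≤ |q| * (δ * ((n + 1) * I) + C) := mul_le_mul_of_nonneg_left hHI (abs_nonneg _)
        _ = (|q| * δ) * ((n + 1) * I) + |q| * C := by ring
        _ ≤ 1 * ((n + 1) * I) + |q| * C := by
          refine add_le_add (mul_le_mul_of_nonneg_right hqδ (by positivity)) le_rfl
        _ = _ := by rw [one_mul]
    have hfin : I * (n + 1) ≤ |q| * C + 2 * N * (n + 1) := by
      nlinarith [mul_le_mul_of_nonneg_left hJN hn1.le]
    rw [← sub_le_iff_le_add, le_div_iff₀ hn1]
    linarith
  refine ⟨|q| * C / (n + 1) + 2 * N, fun r hr => ?_⟩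
  have hpr := (h r hr).1
  have hε : ∀ m : ℕ, 0 < δ / 2 * (1 / ((m : ℝ) + 1)) := fun m => by positivity
  have hlim : Tendsto (fun m : ℕ => δ / 2 * (1 / ((m : ℝ) + 1))) atTop (nhds 0) := by
    simpa using tendsto_one_div_add_atTop_nhds_zero_nat.const_mul (δ / 2)
  refine integrable_and_integral_le_of_tendsto (F := fun m z =>
    trunc (δ / 2 * (1 / ((m : ℝ) + 1))) (r ^ ((k : ℕ) + 1) * dotL v z) ^ n
      * trunc' (δ / 2 * (1 / ((m : ℝ) + 1))) (r ^ ((k : ℕ) + 1) * dotL v z)) ?_ ?_ ?_ ?_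
  · exact fun m => integrable_trunc_pow_mul_trunc' (hε m) n (by fun_prop)
  · exact fun m => Eventually.of_forall fun z =>
      mul_nonneg (hn.pow_nonneg _) (trunc'_pos _ _).le
  · intro m
    refine key r hr _ (hε m) (mul_le_of_le_one_right (by positivity) ?_)
    rw [div_le_one (by positivity)]
    exact le_add_of_nonneg_left (Nat.cast_nonneg m)
  · refine Eventually.of_forall fun z => ?_
    simpa using ((tendsto_trunc hε hlim _).pow n).mul (tendsto_trunc' hlim _)

lemma IsPMatrix.diag_pos (hR : IsPMatrix R) (i : Fin d) : 0 < R i i := by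
  have := hR {i}
  rwa [Matrix.det_eq_elem_of_card_eq_one (by simp) ⟨i, by simp⟩] at this

lemma exists_row_inverse (hdiag : ∀ i, 0 < R i i) (htri : ∀ i j : Fin d, i < j → R i j = 0)
    (k : Fin d) : ∃ v : Fin d → ℝ, (∀ j, uR R v j = if j = k then 1 else 0) ∧
      (∀ j, k < j → v j = 0) ∧ R k k * v k = 1 := by
  have hbt : R.BlockTriangular OrderDual.toDual := fun i j hij => htri i j hij
  have hdet : IsUnit R.det := by
    rw [Matrix.det_of_isLowerTriangular R hbt]
    exact (Finset.prod_pos fun i _ => hdiag i).ne'.isUnit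
  have := Matrix.invertibleOfIsUnitDet R hdet
  have hinv := Matrix.blockTriangular_inv_of_blockTriangular hbt
  have hrow : ∀ j, uR R (R⁻¹ k) j = if j = k then 1 else 0 := fun j => by
    have := congr_fun (congr_fun (Matrix.nonsing_inv_mul R hdet) k) j
    rw [Matrix.mul_apply, Matrix.one_apply] at this
    simpa [uR, eq_comm] using this
  have hzero : ∀ j, k < j → R⁻¹ k j = 0 := fun j hj => hinv hj
  refine ⟨R⁻¹ k, hrow, hzero, ?_⟩
  have hk := hrow k
  rw [if_pos rfl, uR, Finset.sum_eq_single k] at hk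
  · rwa [mul_comm]
  · intro j _ hj
    rcases lt_or_gt_of_ne hj with hlt | hgt
    · rw [htri j k hlt, mul_zero]
    · rw [hzero j hgt, zero_mul]
  · simp

lemma dotL_eq_add_sum_Iio {v : Fin d → ℝ} {k : Fin d} (hv : ∀ j, k < j → v j = 0)
    (z : Fin d → ℝ) : dotL v z = v k * z k + ∑ j ∈ Finset.Iio k, v j * z j := by
  rw [dotL_apply, ← Finset.sum_subset (Finset.subset_univ (Finset.Iic k)),
    ← Finset.Iio_insert, Finset.sum_insert (by simp)]
  intro j _ hj
  rw [Finset.mem_Iic, not_le] at hj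
  rw [hv j hj, zero_mul]

end

/-- All absolute moments of `F r` under `μ r` are bounded uniformly in `r ∈ (0,1)`. -/
def HasUnifMoments {X : Type*} [MeasurableSpace X] (μ : ℝ → Measure X) (F : ℝ → X → ℝ) : Prop :=
  (∀ r ∈ Set.Ioo (0 : ℝ) 1, AEStronglyMeasurable (F r) (μ r)) ∧
    ∀ n : ℕ, UnifIntegralBdd μ (fun r z => |F r z| ^ n)

namespace HasUnifMoments

variable {X : Type*} [MeasurableSpace X] {μ : ℝ → Measure X} {F G : ℝ → X → ℝ}

lemma mono (hG : HasUnifMoments μ G)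
    (hF : ∀ r ∈ Set.Ioo (0 : ℝ) 1, AEStronglyMeasurable (F r) (μ r))
    (h : ∀ r ∈ Set.Ioo (0 : ℝ) 1, ∀ᵐ z ∂(μ r), |F r z| ≤ |G r z|) : HasUnifMoments μ F := by
  refine ⟨hF, fun n => (hG.2 n).mono (fun r hr => (hF r hr).norm.pow n) fun r hr => ?_⟩
  filter_upwards [h r hr] with z hz
  rw [abs_pow, abs_abs]
  exact pow_le_pow_left₀ (abs_nonneg _) hz n

lemma add (hF : HasUnifMoments μ F) (hG : HasUnifMoments μ G) :
    HasUnifMoments μ (fun r z => F r z + G r z) := by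
  have hm : ∀ r ∈ Set.Ioo (0 : ℝ) 1, AEStronglyMeasurable (fun z => F r z + G r z) (μ r) :=
    fun r hr => (hF.1 r hr).add (hG.1 r hr)
  refine ⟨hm, fun n => (((hF.2 n).add (hG.2 n)).const_mul (c := 2 ^ (n - 1)) (by positivity)).mono
    (fun r hr => (hm r hr).norm.pow n) fun r hr => Eventually.of_forall fun z => ?_⟩
  rw [abs_pow, abs_abs]
  exact (pow_le_pow_left₀ (abs_nonneg _) (abs_add_le _ _) n).trans
    (add_pow_le (abs_nonneg _) (abs_nonneg _) n)

lemma const_mul (hF : HasUnifMoments μ F) (c : ℝ) :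
    HasUnifMoments μ (fun r z => c * F r z) := by
  refine ⟨fun r hr => (hF.1 r hr).const_mul c, fun n => ?_⟩
  simp only [abs_mul, mul_pow]
  exact (hF.2 n).const_mul (by positivity)

lemma zero (hμ : ∀ r ∈ Set.Ioo (0 : ℝ) 1, IsProbabilityMeasure (μ r)) :
    HasUnifMoments μ (fun _ _ => 0) :=
  ⟨fun _ _ => aestronglyMeasurable_const, fun n => UnifIntegralBdd.const hμ (|0| ^ n)⟩

lemma sum (hμ : ∀ r ∈ Set.Ioo (0 : ℝ) 1, IsProbabilityMeasure (μ r)) {ι : Type*} (s : Finset ι)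
    {F : ι → ℝ → X → ℝ} (h : ∀ i ∈ s, HasUnifMoments μ (F i)) :
    HasUnifMoments μ (fun r z => ∑ i ∈ s, F i r z) := by
  classical
  induction s using Finset.induction_on with
  | empty => simpa using zero hμ
  | insert i s hi ih =>
    simp only [Finset.sum_insert hi]
    exact (h i (Finset.mem_insert_self i s)).add
      (ih fun j hj => h j (Finset.mem_insert_of_mem hj))

end HasUnifMoments

section

variable {d : ℕ} {Γ R : Matrix (Fin d) (Fin d) ℝ} {π : ℝ → Measure (Fin d → ℝ)}
  {ν : Fin d → ℝ → Measure (Fin d → ℝ)}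

lemma HasUnifMoments.unifIntegralBdd_pow {k : Fin d}
    (hπ : HasUnifMoments π (fun r z => r ^ ((k : ℕ) + 1) * z k)) (n : ℕ) :
    UnifIntegralBdd π (fun r z => (r ^ ((k : ℕ) + 1) * z k) ^ n) := by
  refine (hπ.2 n).mono (fun r hr => (hπ.1 r hr).pow n) fun r hr =>
    Eventually.of_forall fun z => ?_
  rw [abs_pow]

/-- All moments of `r ^ (k + 1) * z k` under `π r` are uniformly bounded. -/
lemma BARFamily.hasUnifMoments (h : BARFamily Γ R π ν) (hdiag : ∀ i, 0 < R i i)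
    (htri : ∀ i j : Fin d, i < j → R i j = 0) (k : Fin d) :
    HasUnifMoments π (fun r z => r ^ ((k : ℕ) + 1) * z k) := by
  induction k using WellFoundedLT.induction with
  | ind k ih =>
  have hpπ : ∀ r ∈ Set.Ioo (0 : ℝ) 1, IsProbabilityMeasure (π r) := fun r hr => (h r hr).1
  have hpν : ∀ r ∈ Set.Ioo (0 : ℝ) 1, IsProbabilityMeasure (ν k r) :=
    fun r hr => ((h r hr).2.2.1 k).1
  obtain ⟨v, hv, hv0, hvk⟩ := exists_row_inverse hdiag htri k
  have hνj : ∀ j ∈ Finset.Iio k,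
      HasUnifMoments (ν k) (fun r z => |v j| * (r * (r ^ ((j : ℕ) + 1) * z j))) := by
    intro j hj
    refine HasUnifMoments.const_mul
      (F := fun r (z : Fin d → ℝ) => r * (r ^ ((j : ℕ) + 1) * z j))
      ⟨fun r hr => Continuous.aestronglyMeasurable (by fun_prop), fun n => ?_⟩ _
    have hb := unifIntegralBdd_nu h hdiag htri j
      (ih j (Finset.mem_Iio.1 hj)).unifIntegralBdd_pow (n + k) k
    refine ((UnifIntegralBdd.const hpν 1).add hb).mono
      (fun r hr => Continuous.aestronglyMeasurable (by fun_prop)) fun r hr => ?_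
    filter_upwards [h.ae_nu hr k] with z hz
    have hY : 0 ≤ r ^ ((j : ℕ) + 1) * z j := mul_nonneg (pow_nonneg hr.1.le _) (hz.1 j)
    rw [abs_pow, abs_abs, abs_of_nonneg (mul_nonneg hr.1.le hY)]
    refine (pow_le_one_add_pow (mul_nonneg hr.1.le hY) (Nat.le_add_right n k)).trans ?_
    rw [mul_pow]
    refine add_le_add le_rfl (mul_le_mul_of_nonneg_right ?_ (pow_nonneg hY _))
    exact pow_le_pow_of_le_one hr.1.le hr.2.le (Nat.le_add_left _ _)
  have hνV : HasUnifMoments (ν k) (fun r z => r ^ ((k : ℕ) + 1) * dotL v z) := by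
    refine (HasUnifMoments.sum hpν (Finset.Iio k) hνj).mono
      (fun r hr => Continuous.aestronglyMeasurable (by fun_prop)) fun r hr => ?_
    filter_upwards [h.ae_nu hr k] with z hz
    rw [dotL_eq_add_sum_Iio hv0, hz.2, mul_zero, zero_add, Finset.mul_sum]
    refine (Finset.abs_sum_le_sum_abs _ _).trans (le_trans ?_ (le_abs_self _))
    refine Finset.sum_le_sum fun j hj => ?_
    rw [abs_mul, abs_mul, abs_of_nonneg (pow_nonneg hr.1.le _), abs_of_nonneg (hz.1 j),
      mul_left_comm, ← mul_assoc r, ← pow_succ']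
    refine mul_le_mul_of_nonneg_left (mul_le_mul_of_nonneg_right ?_ (hz.1 j)) (abs_nonneg _)
    have hjk : j < k := Finset.mem_Iio.1 hj
    exact pow_le_pow_of_le_one hr.1.le hr.2.le (by omega)
  have hπV : HasUnifMoments π (fun r z => r ^ ((k : ℕ) + 1) * dotL v z) := by
    refine ⟨fun r hr => Continuous.aestronglyMeasurable (by fun_prop), fun n => ?_⟩
    have hev : Even (2 * n) := even_two_mul n
    have hb := unifIntegralBdd_pi_dotL h hv hev (by simpa only [hev.pow_abs] using hνV.2 (2 * n))
    refine ((UnifIntegralBdd.const hpπ 1).add hb).mono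
      (fun r hr => Continuous.aestronglyMeasurable (by fun_prop)) fun r hr =>
      Eventually.of_forall fun z => ?_
    rw [abs_pow, abs_abs, ← hev.pow_abs (r ^ ((k : ℕ) + 1) * dotL v z)]
    exact pow_le_one_add_pow (abs_nonneg _) (by omega)
  have hsum : HasUnifMoments π
      (fun r z => ∑ j ∈ Finset.Iio k, |v j| * (r ^ ((j : ℕ) + 1) * z j)) :=
    HasUnifMoments.sum hpπ _ fun j hj => (ih j (Finset.mem_Iio.1 hj)).const_mul |v j|
  have hπV' : HasUnifMoments π (fun r z => |r ^ ((k : ℕ) + 1) * dotL v z|) :=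
    hπV.mono (fun r hr => Continuous.aestronglyMeasurable (by fun_prop)) fun r hr =>
      Eventually.of_forall fun z => (abs_abs _).le
  refine ((hπV'.add hsum).const_mul (R k k)).mono
    (fun r hr => Continuous.aestronglyMeasurable (by fun_prop)) fun r hr => ?_
  filter_upwards [h.ae_pi hr] with z hz
  have hrk : 0 ≤ r ^ ((k : ℕ) + 1) := pow_nonneg hr.1.le _
  have e : r ^ ((k : ℕ) + 1) * z k = R k k * (r ^ ((k : ℕ) + 1) * dotL v z
      - ∑ j ∈ Finset.Iio k, r ^ ((k : ℕ) + 1) * (v j * z j)) := by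
    rw [dotL_eq_add_sum_Iio hv0, ← Finset.mul_sum]
    linear_combination (-(r ^ ((k : ℕ) + 1) * z k)) * hvk
  rw [e, abs_mul, abs_mul]
  refine mul_le_mul_of_nonneg_left ?_ (abs_nonneg _)
  refine le_trans ((abs_sub _ _).trans (add_le_add le_rfl ?_)) (le_abs_self _)
  refine (Finset.abs_sum_le_sum_abs _ _).trans (Finset.sum_le_sum fun j hj => ?_)
  rw [abs_mul, abs_mul, abs_of_nonneg hrk, abs_of_nonneg (hz j), mul_left_comm]
  refine mul_le_mul_of_nonneg_left (mul_le_mul_of_nonneg_right ?_ (hz j)) (abs_nonneg _)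
  have hjk : j < k := Finset.mem_Iio.1 hj
  exact pow_le_pow_of_le_one hr.1.le hr.2.le (by omega)

/-- If `r ^ i * Y ^ n` has uniformly bounded integrals for every `n`, then `r * ∫ Y ^ n` vanishes
as `r → 0`. -/
lemma tendsto_mul_integral_of_unifIntegralBdd {X : Type*} [MeasurableSpace X] {μ : ℝ → Measure X}
    {Y : ℝ → X → ℝ} (hμ : ∀ r ∈ Set.Ioo (0 : ℝ) 1, IsProbabilityMeasure (μ r))
    (hY : ∀ r ∈ Set.Ioo (0 : ℝ) 1, ∀ᵐ z ∂(μ r), 0 ≤ Y r z) (i : ℕ)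
    (hb : ∀ n, UnifIntegralBdd μ (fun r z => r ^ i * Y r z ^ n)) (n : ℕ) :
    Tendsto (fun r : ℝ => r * ∫ z, Y r z ^ n ∂(μ r)) (nhdsWithin 0 (Set.Ioo 0 1)) (nhds 0) := by
  obtain ⟨C, hC⟩ := hb (n * (2 * i + 1))
  have hlim : Tendsto (fun r : ℝ => √r + r * C) (nhdsWithin 0 (Set.Ioo 0 1)) (nhds 0) := by
    have : Continuous fun r : ℝ => √r + r * C := by fun_prop
    simpa using (this.tendsto 0).mono_left nhdsWithin_le_nhds
  refine squeeze_zero_norm' ?_ hlim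
  filter_upwards [self_mem_nhdsWithin] with r hr
  have hpr := hμ r hr
  have hs2 : √r ^ 2 = r := Real.sq_sqrt hr.1.le
  have hs := Real.sqrt_nonneg r
  rw [← integral_const_mul]
  have hint : Integrable (fun z => √r + r * (r ^ i * Y r z ^ (n * (2 * i + 1)))) (μ r) :=
    (integrable_const _).add ((hC r hr).1.const_mul r)
  refine (norm_integral_le_of_norm_le hint ?_).trans ?_
  · filter_upwards [hY r hr] with z hz
    have hx : 0 ≤ Y r z ^ n := pow_nonneg hz n
    rw [Real.norm_of_nonneg (mul_nonneg hr.1.le hx), pow_mul]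
    have h1 := pow_le_one_add_pow (mul_nonneg hs hx) (show 1 ≤ 2 * i + 1 by omega)
    have h2 := mul_le_mul_of_nonneg_left h1 hs
    have e1 : √r * (√r * Y r z ^ n) ^ 1 = r * Y r z ^ n := by
      rw [pow_one, ← mul_assoc, ← pow_two, hs2]
    have e2 : √r * (1 + (√r * Y r z ^ n) ^ (2 * i + 1))
        = √r + √r ^ 2 * ((√r ^ 2) ^ i * (Y r z ^ n) ^ (2 * i + 1)) := by
      rw [mul_pow]
      ring
    rwa [e1, e2, hs2] at h2
  · rw [integral_add (integrable_const _) ((hC r hr).1.const_mul r), integral_const_mul]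
    simpa using mul_le_mul_of_nonneg_left (hC r hr).2 hr.1.le

end

/-- Uniform moment bounds for a lower triangular P-reflection matrix;
in particular the uniform moment bound condition holds. -/
theorem uniform_moment_bounds_lower_triangular
    {d : ℕ} (hd : 1 ≤ d)
    (Γ R : Matrix (Fin d) (Fin d) ℝ)
    (hΓsymm : Γ.IsSymm) (hΓpd : Γ.PosDef)
    (hR : IsPMatrix R) (htri : ∀ i j : Fin d, i < j → R i j = 0)
    (π : ℝ → Measure (Fin d → ℝ)) (ν : Fin d → ℝ → Measure (Fin d → ℝ))
    (hBAR : BARFamily Γ R π ν) :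
    (∃ r₀ ∈ Set.Ioc (0 : ℝ) 1, ∀ k : Fin d, ∀ n : ℕ,
      ∃ C : ℝ, ∃ Cb : Fin d → ℝ, ∀ r ∈ Set.Ioo (0 : ℝ) r₀,
        (∫ z, (r ^ ((k : ℕ) + 1) * z k) ^ n ∂(π r)) < C ∧
        ∀ i : Fin d,
          r ^ (i : ℕ) * (∫ z, (r ^ ((k : ℕ) + 1) * z k) ^ n ∂(ν i r)) < Cb i) ∧
    UniformMomentBound π ν := by
  have hdiag : ∀ i, 0 < R i i := hR.diag_pos
  have hπ : ∀ (k : Fin d) (n : ℕ),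
      UnifIntegralBdd π (fun r z => (r ^ ((k : ℕ) + 1) * z k) ^ n) :=
    fun k n => (hBAR.hasUnifMoments hdiag htri k).unifIntegralBdd_pow n
  have hν := fun k n i => unifIntegralBdd_nu hBAR hdiag htri k (hπ k) n i
  refine ⟨⟨1, by simp, fun k n => ?_⟩, fun i k => ⟨?_, ?_⟩⟩
  · obtain ⟨C, hC⟩ := hπ k n
    choose D hD using hν k n
    refine ⟨C + 1, fun i => D i + 1, fun r hr => ⟨(hC r hr).2.trans_lt (lt_add_one C),
      fun i => ?_⟩⟩
    have := (hD i r hr).2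
    rw [integral_const_mul] at this
    exact this.trans_lt (lt_add_one _)
  · obtain ⟨C, hC⟩ := hπ k d
    exact ⟨1, one_pos, C, fun r hr => (hC r (by simpa using hr)).2⟩
  · refine tendsto_mul_integral_of_unifIntegralBdd (fun r hr => ((hBAR r hr).2.2.1 i).1)
      (fun r hr => ?_) i (fun n => hν k n i) d
    filter_upwards [hBAR.ae_nu hr i] with z hz
    exact mul_nonneg (pow_nonneg hr.1.le _) (hz.1 k)

end SRBMPaper
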